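/- arXiv:1711.06065 — 2 statements merged into one kernel-verified Lean document; each statement's English description precedes it below -/
import Mathlib

section
/- Let C be a category with an (Epi, Mono)-factorization system and S a subcategory of C. Assume there is no infinite strictly descending chain X ← S₁ ← S₂ ← ⋯ of proper M_S-subobjects, and that the intersection of any two M_S-subobjects of an object X of C exists and is an M_S-subobject of X. Then the intersection of any nonempty set of M_S-subobjects of an object X of C exists and is an M_S-subobject of X. -/
open CategoryTheory Limits

universe v u

/-- An arrow of `C` is `S`-small if it factors through an object of `S`
(here `S` is a (full) subcategory of `C`, given by its class of objects). -/
def SSmall {C : Type u} [Category.{v} C] (S : Set C) {X Y : C} (f : X ⟶ Y) : Prop :=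
  ∃ Z : C, Z ∈ S ∧ ∃ (u : X ⟶ Z) (v : Z ⟶ Y), u ≫ v = f

/-- A factorization system through a subcategory `S` (given by its class of objects)
on `C`: a pair `(E, M)` of classes of arrows such that codomains of `E`-arrows and
domains of `M`-arrows lie in `S`, `E` is closed under postcomposition (and `M` under
precomposition) with isomorphisms of `S`, every `S`-small arrow admits an
`(E, M)`-factorization, and the unique diagonalization property holds. -/
structure FactorizationThrough {C : Type u} [Category.{v} C] (S : Set C)
    (E M : MorphismProperty C) : Prop where
  /-- codomains of `E`-arrows are in `S` -/
  mem_of_E : ∀ {X Y : C} (f : X ⟶ Y), E f → Y ∈ S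
  /-- domains of `M`-arrows are in `S` -/
  mem_of_M : ∀ {X Y : C} (f : X ⟶ Y), M f → X ∈ S
  /-- `E` is closed under postcomposition with isomorphisms of `S` -/
  E_comp_iso : ∀ {X Y Z : C} (f : X ⟶ Y) (i : Y ⟶ Z), E f → IsIso i → Y ∈ S → Z ∈ S →
    E (f ≫ i)
  /-- `M` is closed under precomposition with isomorphisms of `S` -/
  M_iso_comp : ∀ {X Y Z : C} (i : X ⟶ Y) (m : Y ⟶ Z), M m → IsIso i → X ∈ S → Y ∈ S →
    M (i ≫ m)
  /-- every `S`-small arrow admits an `(E, M)`-factorization -/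
  fact : ∀ {X Y : C} (f : X ⟶ Y), SSmall S f →
    ∃ (Z : C) (e : X ⟶ Z) (m : Z ⟶ Y), E e ∧ M m ∧ e ≫ m = f
  /-- the unique diagonalization property -/
  diag : ∀ {X T Z Y : C} (e : X ⟶ T) (g : T ⟶ Y) (f : X ⟶ Z) (m : Z ⟶ Y),
    E e → M m → e ≫ g = f ≫ m → ∃! u : T ⟶ Z, e ≫ u = f ∧ u ≫ m = g

universe w

/-- The right class of a factorization system is left cancellable. -/
theorem FactorizationThrough.of_comp {C : Type u} [Category.{v} C] {E M : MorphismProperty C}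
    (h : FactorizationThrough Set.univ E M) {X Y Z : C} {k : X ⟶ Y} {m : Y ⟶ Z}
    (hm : M m) (hkm : M (k ≫ m)) : M k := by
  obtain ⟨T, e, n, he, hn, rfl⟩ := h.fact k ⟨X, trivial, 𝟙 X, k, by simp⟩
  obtain ⟨r, ⟨her, hr⟩, -⟩ := h.diag e (n ≫ m) (𝟙 X) ((e ≫ n) ≫ m) he hkm (by simp)
  have hrn : r ≫ e ≫ n = n :=
    (h.diag e (n ≫ m) (e ≫ n) m he hm (by simp)).unique
      ⟨by rw [reassoc_of% her], by simpa using hr⟩ ⟨rfl, rfl⟩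
  have hre : r ≫ e = 𝟙 T :=
    (h.diag e n e n he hn rfl).unique
      ⟨by rw [reassoc_of% her], by simpa using hrn⟩ ⟨by simp, by simp⟩
  exact h.M_iso_comp e n hn ⟨r, her, hre⟩ trivial trivial

/-- If there is no infinite strictly descending chain of proper `M_S`-subobjects, and
binary intersections of `M_S`-subobjects exist and are `M_S`-subobjects, then the
intersection of any nonempty family of `M_S`-subobjects of an object exists and is an
`M_S`-subobject. -/
theorem intersections_of_wellFounded {C : Type u} [Category.{v} C]
    (EpiC MonoC : MorphismProperty C)
    (hfs : FactorizationThrough Set.univ EpiC MonoC) (S : Set C)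
    -- no infinite strictly descending chain of proper `M_S`-subobjects
    (hchain : ¬ ∃ (obj : ℕ → C) (g : ∀ n : ℕ, obj (n + 1) ⟶ obj n),
      (∀ n, MonoC (g n)) ∧ (∀ n, obj (n + 1) ∈ S) ∧ (∀ n, ¬ IsIso (g n)))
    -- binary intersections of `M_S`-subobjects exist and are `M_S`-subobjects
    (hbin : ∀ {X S₁ S₂ : C} (m₁ : S₁ ⟶ X) (m₂ : S₂ ⟶ X),
      MonoC m₁ → S₁ ∈ S → MonoC m₂ → S₂ ∈ S →
      ∃ (P : C) (p : P ⟶ X), MonoC p ∧ P ∈ S ∧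
        (∃ k : P ⟶ S₁, k ≫ m₁ = p) ∧ (∃ k : P ⟶ S₂, k ≫ m₂ = p) ∧
        (∀ {W : C} (n : W ⟶ X), MonoC n →
          (∃ k : W ⟶ S₁, k ≫ m₁ = n) → (∃ k : W ⟶ S₂, k ≫ m₂ = n) →
          ∃ k : W ⟶ P, k ≫ p = n)) :
    -- then arbitrary nonempty intersections of `M_S`-subobjects exist and are
    -- `M_S`-subobjects
    ∀ {X : C} {ι : Type w} [Nonempty ι] (So : ι → C) (m : ∀ i, So i ⟶ X),
      (∀ i, MonoC (m i) ∧ So i ∈ S) →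
      ∃ (P : C) (p : P ⟶ X), MonoC p ∧ P ∈ S ∧
        (∀ i, ∃ k : P ⟶ So i, k ≫ m i = p) ∧
        (∀ {W : C} (n : W ⟶ X), MonoC n → (∀ i, ∃ k : W ⟶ So i, k ≫ m i = n) →
          ∃ k : W ⟶ P, k ≫ p = n) := by
  intro X ι _ So m hm
  by_contra hcon
  -- the `M_S`-subobjects of `X` above every common lower bound of the family
  let T := {q : Σ P : C, P ⟶ X // MonoC q.2 ∧ q.1 ∈ S ∧
    ∀ {W : C} (n : W ⟶ X), MonoC n → (∀ i, ∃ k : W ⟶ So i, k ≫ m i = n) →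
      ∃ k : W ⟶ q.1, k ≫ q.2 = n}
  have step (t : T) : ∃ (t' : T) (k : t'.1.1 ⟶ t.1.1), MonoC k ∧ ¬ IsIso k := by
    obtain ⟨⟨P, p⟩, hp, hP, hglb⟩ := t
    obtain ⟨i, hi⟩ : ∃ i, ¬ ∃ k : P ⟶ So i, k ≫ m i = p := by
      by_contra! hall
      exact hcon ⟨P, p, hp, hP, hall, hglb⟩
    obtain ⟨Q, q, hq, hQ, ⟨k, hk⟩, ⟨l, hl⟩, hQglb⟩ := hbin p (m i) hp hP (hm i).1 (hm i).2
    refine ⟨⟨⟨Q, q⟩, hq, hQ, fun n hn hfac => hQglb n hn (hglb n hn hfac) (hfac i)⟩, k,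
      hfs.of_comp hp (hk ▸ hq), fun _ => hi ⟨inv k ≫ l, ?_⟩⟩
    rw [Category.assoc, hl, ← hk, IsIso.inv_hom_id_assoc]
  choose next g hg hiso using step
  obtain ⟨i₀⟩ := ‹Nonempty ι›
  let t₀ : T := ⟨⟨So i₀, m i₀⟩, (hm i₀).1, (hm i₀).2, fun _ _ hfac => hfac i₀⟩
  let t : ℕ → T := fun n => Nat.rec t₀ (fun _ => next) n
  exact hchain ⟨fun n => (t n).1.1, fun n => g (t n), fun n => hg (t n),
    fun n => (t (n + 1)).2.2.1, fun n => hiso (t n)⟩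
end

section
/- Let K be an infinite field and V a finite-dimensional K-vector space. Every subset A of V admits a minimal cover by a finite union of linear subspaces: there exist finitely many linear subspaces S₁, …, Sₙ of V with A ⊆ S₁ ∪ ⋯ ∪ Sₙ such that for every finite family T₁, …, Tₘ of linear subspaces of V with A ⊆ T₁ ∪ ⋯ ∪ Tₘ one has S₁ ∪ ⋯ ∪ Sₙ ⊆ T₁ ∪ ⋯ ∪ Tₘ. -/
/-- In an Artinian module, the part of a set `A` lying in a submodule `W` has a minimal cover
by finitely many submodules. No assumption on the size of the scalar ring is needed. -/
theorem Submodule.exists_minimal_finite_cover_inter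
    {R M : Type*} [Ring R] [AddCommGroup M] [Module R M] [IsArtinian R M]
    (A : Set M) (W : Submodule R M) :
    ∃ 𝒮 : Finset (Submodule R M),
      (A ∩ W ⊆ ⋃ S ∈ 𝒮, (S : Set M)) ∧
      ∀ 𝒯 : Finset (Submodule R M), (A ∩ W ⊆ ⋃ T ∈ 𝒯, (T : Set M)) →
        (⋃ S ∈ 𝒮, (S : Set M)) ⊆ ⋃ T ∈ 𝒯, (T : Set M) := by
  classical
  induction W using WellFoundedLT.induction with
  | ind W ih =>
  by_cases h : ∃ 𝒰 : Finset (Submodule R M),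
      (∀ U ∈ 𝒰, U < W) ∧ A ∩ W ⊆ ⋃ U ∈ 𝒰, (U : Set M)
  · obtain ⟨𝒰, hlt, hcover⟩ := h
    choose! F hF hmin using ih
    refine ⟨𝒰.biUnion F, fun x hx ↦ ?_, fun 𝒯 hT x hx ↦ ?_⟩
    · obtain ⟨U, hU, hxU⟩ := Set.mem_iUnion₂.1 (hcover hx)
      obtain ⟨S, hS, hxS⟩ := Set.mem_iUnion₂.1 (hF U (hlt U hU) ⟨hx.1, hxU⟩)
      exact Set.mem_iUnion₂.2 ⟨S, Finset.mem_biUnion.2 ⟨U, hU, hS⟩, hxS⟩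
    · obtain ⟨S, hS, hxS⟩ := Set.mem_iUnion₂.1 hx
      obtain ⟨U, hU, hSU⟩ := Finset.mem_biUnion.1 hS
      exact hmin U (hlt U hU) 𝒯 (fun y hy ↦ hT ⟨hy.1, (hlt U hU).le hy.2⟩)
        (Set.mem_iUnion₂.2 ⟨S, hSU, hxS⟩)
  · refine ⟨{W}, by simp, fun 𝒯 hT ↦ ?_⟩
    suffices ∃ T ∈ 𝒯, W ≤ T by
      obtain ⟨T, hT, hWT⟩ := this
      simpa using (SetLike.coe_subset_coe.2 hWT).trans
        (Set.subset_biUnion_of_mem (u := fun T : Submodule R M ↦ (T : Set M)) hT)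
    by_contra! hW
    refine h ⟨𝒯.image (· ⊓ W), ?_, fun x hx ↦ ?_⟩
    · simpa using hW
    · obtain ⟨T, hT, hxT⟩ := Set.mem_iUnion₂.1 (hT hx)
      exact Set.mem_iUnion₂.2 ⟨T ⊓ W, Finset.mem_image_of_mem _ hT, hxT, hx.2⟩

/-- Over an infinite field, every subset `A` of a finite-dimensional vector space `V`
admits a minimal cover by a finite union of linear subspaces: there is a finite family
of subspaces whose union contains `A` and is contained in the union of every finite
family of subspaces covering `A`. -/
theorem exists_minimal_finite_subspace_cover
    (K : Type*) [Field K] [Infinite K]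
    (V : Type*) [AddCommGroup V] [Module K V] [FiniteDimensional K V]
    (A : Set V) :
    ∃ 𝒮 : Finset (Submodule K V),
      (A ⊆ ⋃ S ∈ 𝒮, (S : Set V)) ∧
      ∀ 𝒯 : Finset (Submodule K V), (A ⊆ ⋃ T ∈ 𝒯, (T : Set V)) →
        (⋃ S ∈ 𝒮, (S : Set V)) ⊆ ⋃ T ∈ 𝒯, (T : Set V) := by
  simpa using Submodule.exists_minimal_finite_cover_inter A (⊤ : Submodule K V)
end
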